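/- Suppose the decision-theoretic kernel p(W_V | F_A) obeys distributional consistency and the augmented DAG local Markov property for 𝒢*. Then the observational distribution p(W_V | F_A = ∅) obeys the ordinary ordered local Markov property with respect to 𝒢 and ≺: for every i ∈ V and every w* ∈ 𝔛_{pre(i)} with p(W_{pre(i)} = w* | F_A = ∅) > 0, the conditional distribution p(W_i = · | W_{pre(i)} = w*, F_A = ∅) is a function only of w*_{pa(i)}. -/

import Mathlib

open Finset

namespace CausalPaper

variable {V : Type*} [Fintype V] [LinearOrder V]
variable {𝔛 : V → Type*} [∀ i, Fintype (𝔛 i)]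

/-- Probability of the event `E` under the distribution `q` on joint assignments. -/
noncomputable def pr (q : (∀ i, 𝔛 i) → ℝ) (E : (∀ i, 𝔛 i) → Prop) : ℝ :=
  ∑ v : (∀ i, 𝔛 i), Set.indicator (setOf E) q v

/-- Conditional probability of `E` given `F` under `q`. -/
noncomputable def cpr (q : (∀ i, 𝔛 i) → ℝ) (E F : (∀ i, 𝔛 i) → Prop) : ℝ :=
  pr q (fun v => E v ∧ F v) / pr q F

/-- `q` is a probability distribution on joint assignments. -/
def IsProb (q : (∀ i, 𝔛 i) → ℝ) : Prop :=
  (∀ v, 0 ≤ q v) ∧ (∑ v : (∀ i, 𝔛 i), q v) = 1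

/-- `v` agrees with `s` on the coordinates in `S`. -/
def agree (S : Finset V) (s v : ∀ i, 𝔛 i) : Prop :=
  ∀ i ∈ S, v i = s i

/-- The intervention/regime that sets the variables in `B` according to `b`
(and is idle elsewhere). -/
def setOn (B : Finset V) (b : ∀ i, 𝔛 i) : ∀ i, Option (𝔛 i) :=
  fun i => if i ∈ B then some (b i) else none

/-- The support of the partial intervention/regime `f` is contained in `A`. -/
def suppIn (f : ∀ i, Option (𝔛 i)) (A : Finset V) : Prop :=
  ∀ i, f i ≠ none → i ∈ A

/-- Distributional consistency. -/
def DistConsistent (A : Finset V) (P : (∀ i, Option (𝔛 i)) → (∀ i, 𝔛 i) → ℝ) : Prop :=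
  ∀ i ∈ A, ∀ C : Finset V, C ⊆ A \ {i} →
    ∀ (y : ∀ j, 𝔛 j) (b : 𝔛 i) (c : ∀ j, 𝔛 j),
      pr (P (Function.update (setOn C c) i (some b)))
          (fun v => agree (univ \ {i}) y v ∧ v i = b)
        = pr (P (setOn C c)) (fun v => agree (univ \ {i}) y v ∧ v i = b)

/-- The predecessors of `i` under the total order on `V`. -/
def pre (i : V) : Finset V := univ.filter (fun j => j < i)

/-- The (SWIG / augmented-DAG) ordered local Markov property: under the regime
intervening on all of `A`, the conditional distribution of `X_i` given its
predecessors is a function only of `a` on `pa i ∩ A` and of `w` on `pa i \ A`. -/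
def AugmentedLocalMarkov (A : Finset V) (pa : V → Finset V)
    (P : (∀ i, Option (𝔛 i)) → (∀ i, 𝔛 i) → ℝ) : Prop :=
  ∀ (i : V) (a a' w w' : ∀ j, 𝔛 j) (x : 𝔛 i),
    0 < pr (P (setOn A a)) (agree (pre i) w) →
    0 < pr (P (setOn A a')) (agree (pre i) w') →
    (∀ j ∈ pa i ∩ A, a j = a' j) →
    (∀ j ∈ pa i \ A, w j = w' j) →
    cpr (P (setOn A a)) (fun v => v i = x) (agree (pre i) w)
      = cpr (P (setOn A a')) (fun v => v i = x) (agree (pre i) w')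

/-- The ordinary ordered local Markov property for a single distribution `q`:
the conditional distribution of `X_i` given its predecessors is a function only
of the values of the parents. -/
def OrderedLocalMarkov (pa : V → Finset V) (q : (∀ i, 𝔛 i) → ℝ) : Prop :=
  ∀ (i : V) (w w' : ∀ j, 𝔛 j) (x : 𝔛 i),
    0 < pr q (agree (pre i) w) →
    0 < pr q (agree (pre i) w') →
    (∀ j ∈ pa i, w j = w' j) →
    cpr q (fun v => v i = x) (agree (pre i) w)
      = cpr q (fun v => v i = x) (agree (pre i) w')

open Classical in
theorem pr_eq_sum_ite (q : (∀ i, 𝔛 i) → ℝ) (E : (∀ i, 𝔛 i) → Prop) :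
    pr q E = ∑ v, if E v then q v else 0 :=
  Finset.sum_congr rfl fun v _ => Set.indicator_apply _ q v

theorem pr_congr (q : (∀ i, 𝔛 i) → ℝ) {E F : (∀ i, 𝔛 i) → Prop} (h : ∀ v, E v ↔ F v) :
    pr q E = pr q F := by
  rw [show E = F from funext fun v => propext (h v)]

theorem pr_mono {q : (∀ i, 𝔛 i) → ℝ} (hq : ∀ v, 0 ≤ q v) {E F : (∀ i, 𝔛 i) → Prop}
    (h : ∀ v, E v → F v) : pr q E ≤ pr q F :=
  Finset.sum_le_sum fun v _ =>
    Set.indicator_le_indicator_of_subset (fun v hv => h v hv) hq v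

theorem pr_nonneg {q : (∀ i, 𝔛 i) → ℝ} (hq : ∀ v, 0 ≤ q v) (E : (∀ i, 𝔛 i) → Prop) :
    0 ≤ pr q E :=
  Finset.sum_nonneg fun v _ => Set.indicator_nonneg (fun v _ => hq v) v

/-- The probability of an event concentrated at a single assignment. -/
theorem pr_eq_apply (q : (∀ i, 𝔛 i) → ℝ) (E : (∀ i, 𝔛 i) → Prop) (u : ∀ i, 𝔛 i)
    (h : ∀ v, E v ↔ v = u) : pr q E = q u := by
  classical
  simp [pr_eq_sum_ite, h]

/-- Law of total probability over the values of the coordinate `j`. -/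
theorem pr_eq_sum_fiber (q : (∀ i, 𝔛 i) → ℝ) (E : (∀ i, 𝔛 i) → Prop) (j : V) :
    pr q E = ∑ b : 𝔛 j, pr q (fun v => v j = b ∧ E v) := by
  classical
  simp only [pr_eq_sum_ite]
  rw [Finset.sum_comm]
  refine Finset.sum_congr rfl fun v _ => ?_
  by_cases hE : E v <;> simp [hE]

theorem pr_and_eq_cpr_mul {q : (∀ i, 𝔛 i) → ℝ} (hq : ∀ v, 0 ≤ q v)
    (E F : (∀ i, 𝔛 i) → Prop) :
    pr q (fun v => E v ∧ F v) = cpr q E F * pr q F := by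
  rw [cpr, div_mul_cancel_of_imp]
  intro h
  exact le_antisymm (h ▸ pr_mono hq fun v hv => hv.2) (pr_nonneg hq _)

theorem mem_pre {i j : V} : j ∈ pre i ↔ j < i := by
  simp [pre]

theorem agree_pre_of_covBy {j k : V} (h : j ⋖ k) (w v : ∀ i, 𝔛 i) :
    agree (pre k) w v ↔ v j = w j ∧ agree (pre j) w v := by
  constructor
  · intro H
    exact ⟨H j (mem_pre.2 h.lt), fun l hl => H l (mem_pre.2 ((mem_pre.1 hl).trans h.lt))⟩
  · rintro ⟨h1, h2⟩ l hl
    rcases (h.le_of_lt (mem_pre.1 hl)).eq_or_lt with rfl | hlt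
    · exact h1
    · exact h2 l (mem_pre.2 hlt)

theorem agree_pre_update (j : V) (x : 𝔛 j) (w v : ∀ i, 𝔛 i) :
    agree (pre j) (Function.update w j x) v ↔ agree (pre j) w v := by
  refine forall₂_congr fun l hl => ?_
  rw [Function.update_of_ne (mem_pre.1 hl).ne]

theorem agree_pre_update_of_covBy {j k : V} (h : j ⋖ k) (x : 𝔛 j) (w v : ∀ i, 𝔛 i) :
    agree (pre k) (Function.update w j x) v ↔ v j = x ∧ agree (pre j) w v := by
  rw [agree_pre_of_covBy h, Function.update_self, agree_pre_update]

theorem suppIn_setOn (A : Finset V) (a : ∀ i, 𝔛 i) : suppIn (setOn A a) A := by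
  intro i hi
  by_contra h
  exact hi (if_neg h)

theorem setOn_insert (C : Finset V) (i : V) (v : ∀ i, 𝔛 i) :
    setOn (insert i C) v = Function.update (setOn C v) i (some (v i)) := by
  funext j
  rcases eq_or_ne j i with rfl | h
  · simp [setOn]
  · simp [setOn, h]

/-- Distributional consistency, iterated: setting variables to their realised values
does not change the probability of an assignment. -/
theorem DistConsistent.setOn_apply {A : Finset V}
    {P : (∀ i, Option (𝔛 i)) → (∀ i, 𝔛 i) → ℝ} (hDC : DistConsistent A P)
    (v : ∀ i, 𝔛 i) {C : Finset V} (hC : C ⊆ A) :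
    P (setOn C v) v = P (fun _ => none) v := by
  induction C using Finset.induction_on with
  | empty =>
    congr 1
  | insert i C hi ih =>
    rw [← ih ((Finset.subset_insert i C).trans hC), setOn_insert]
    have hCA : C ⊆ A \ {i} := fun j hj => by
      have : j ≠ i := fun h => hi (h ▸ hj)
      simp [hC (Finset.mem_insert_of_mem hj), this]
    have hev : ∀ u, agree (univ \ {i}) v u ∧ u i = v i ↔ u = v := by
      refine fun u => ⟨fun h => funext fun j => ?_, ?_⟩
      · rcases eq_or_ne j i with rfl | hj
        · exact h.2
        · exact h.1 j (by simp [hj])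
      · rintro rfl
        exact ⟨fun _ _ => rfl, rfl⟩
    have key := hDC i (hC (Finset.mem_insert_self i C)) C hCA v (v i) v
    rwa [pr_eq_apply _ _ v hev, pr_eq_apply _ _ v hev] at key

section

variable {A : Finset V} {pa : V → Finset V}
  {P : (∀ i, Option (𝔛 i)) → (∀ i, 𝔛 i) → ℝ}

theorem AugmentedLocalMarkov.pr_and_congr (hM : AugmentedLocalMarkov A pa P)
    (hpa : ∀ i, pa i ⊆ pre i) (hP : ∀ f, suppIn f A → IsProb (P f))
    {j : V} {a a' w : ∀ i, 𝔛 i} (haa : ∀ l < j, a l = a' l)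
    (h : pr (P (setOn A a)) (agree (pre j) w) = pr (P (setOn A a')) (agree (pre j) w))
    (x : 𝔛 j) :
    pr (P (setOn A a)) (fun v => v j = x ∧ agree (pre j) w v)
      = pr (P (setOn A a')) (fun v => v j = x ∧ agree (pre j) w v) := by
  have hq := fun b : ∀ i, 𝔛 i => (hP _ (suppIn_setOn A b)).1
  rw [pr_and_eq_cpr_mul (hq a) (fun v => v j = x), pr_and_eq_cpr_mul (hq a') (fun v => v j = x)]
  rcases (pr_nonneg (hq a) (agree (pre j) w)).eq_or_lt with h0 | hpos
  · rw [← h, ← h0, mul_zero, mul_zero]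
  · rw [hM j a a' w w x hpos (h ▸ hpos)
      (fun l hl => haa l (mem_pre.1 (hpa j (Finset.mem_inter.1 hl).1))) (fun _ _ => rfl), h]

/-- The law of the predecessors of `j` is unaffected by interventions on `j` and later
variables. -/
theorem AugmentedLocalMarkov.pr_agree_pre_congr (hM : AugmentedLocalMarkov A pa P)
    (hpa : ∀ i, pa i ⊆ pre i) (hP : ∀ f, suppIn f A → IsProb (P f))
    (j : V) {a a' : ∀ i, 𝔛 i} (w : ∀ i, 𝔛 i) (haa : ∀ l < j, a l = a' l) :
    pr (P (setOn A a)) (agree (pre j) w) = pr (P (setOn A a')) (agree (pre j) w) := by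
  induction j using WellFoundedLT.induction with
  | ind j ih =>
    by_cases hj : IsMin j
    · have hone : ∀ b : ∀ i, 𝔛 i, pr (P (setOn A b)) (agree (pre j) w) = 1 := by
        intro b
        have hev : ∀ v, agree (pre j) w v ↔ True := fun v =>
          iff_true_intro fun l hl => absurd (mem_pre.1 hl) hj.not_lt
        rw [pr_congr _ hev, ← (hP _ (suppIn_setOn A b)).2]
        simp [pr_eq_sum_ite]
      rw [hone, hone]
    · obtain ⟨k, hk⟩ := exists_covBy_of_wellFoundedGT hj
      have hlt : ∀ l < k, a l = a' l := fun l hl => haa l (hl.trans hk.lt)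
      rw [pr_congr _ (agree_pre_of_covBy hk w), pr_congr _ (agree_pre_of_covBy hk w)]
      exact hM.pr_and_congr hpa hP hlt (ih k hk.lt hlt) (w k)

/-- The law of the variables up to `j` is unaffected by interventions on `j` and later
variables. -/
theorem AugmentedLocalMarkov.pr_and_agree_pre_congr (hM : AugmentedLocalMarkov A pa P)
    (hpa : ∀ i, pa i ⊆ pre i) (hP : ∀ f, suppIn f A → IsProb (P f))
    (j : V) {a a' : ∀ i, 𝔛 i} (w : ∀ i, 𝔛 i) (haa : ∀ l < j, a l = a' l) (x : 𝔛 j) :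
    pr (P (setOn A a)) (fun v => v j = x ∧ agree (pre j) w v)
      = pr (P (setOn A a')) (fun v => v j = x ∧ agree (pre j) w v) :=
  hM.pr_and_congr hpa hP haa (hM.pr_agree_pre_congr hpa hP j w haa) x

theorem pr_none_and_agree_pre (hpa : ∀ i, pa i ⊆ pre i)
    (hP : ∀ f, suppIn f A → IsProb (P f)) (hDC : DistConsistent A P)
    (hM : AugmentedLocalMarkov A pa P) (j : V) (w : ∀ i, 𝔛 i) (x : 𝔛 j) :
    pr (P fun _ => none) (fun v => v j = x ∧ agree (pre j) w v)
      = pr (P (setOn A w)) (fun v => v j = x ∧ agree (pre j) w v) := by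
  induction j using WellFoundedGT.induction generalizing w with
  | ind j ih =>
    rw [hM.pr_and_agree_pre_congr hpa hP j w (a := w) (a' := Function.update w j x)
      (fun l hl => (Function.update_of_ne hl.ne x w).symm)]
    by_cases hj : IsMax j
    · have hev : ∀ v, v j = x ∧ agree (pre j) w v ↔ v = Function.update w j x := by
        intro v
        rw [Function.eq_update_iff]
        refine and_congr_right fun _ => forall_congr' fun l => ?_
        rw [mem_pre, lt_iff_le_and_ne, and_iff_right (hj.isTop l)]
      rw [pr_eq_apply _ _ _ hev, pr_eq_apply _ _ _ hev, hDC.setOn_apply _ subset_rfl]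
    · obtain ⟨k, hk⟩ := exists_covBy_of_wellFoundedLT hj
      have hev := fun v => (agree_pre_update_of_covBy hk x w v).symm
      rw [pr_congr _ hev, pr_congr _ hev, pr_eq_sum_fiber _ _ k, pr_eq_sum_fiber _ _ k]
      exact Finset.sum_congr rfl fun b _ => ih k hk.lt _ b

theorem pr_none_agree_pre (hpa : ∀ i, pa i ⊆ pre i)
    (hP : ∀ f, suppIn f A → IsProb (P f)) (hDC : DistConsistent A P)
    (hM : AugmentedLocalMarkov A pa P) (j : V) (w : ∀ i, 𝔛 i) :
    pr (P fun _ => none) (agree (pre j) w) = pr (P (setOn A w)) (agree (pre j) w) := by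
  rw [pr_eq_sum_fiber _ _ j, pr_eq_sum_fiber _ _ j]
  exact Finset.sum_congr rfl fun b _ => pr_none_and_agree_pre hpa hP hDC hM j w b

end

/-- The observational distribution `p(W_V | F_A = ∅) = P (fun _ => none)` obeys the
ordinary ordered local Markov property with respect to the original DAG. -/
theorem stmt14_kernel_observed_markov
    (A : Finset V) (hA : A ⊆ univ)
    (pa : V → Finset V) (hpa : ∀ i, pa i ⊆ pre i)
    (P : (∀ i, Option (𝔛 i)) → (∀ i, 𝔛 i) → ℝ)
    (hP : ∀ f, suppIn f A → IsProb (P f))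
    (hDC : DistConsistent A P)
    (hM : AugmentedLocalMarkov A pa P) :
    OrderedLocalMarkov pa (P (fun _ => none)) := by
  intro i w w' x hw hw' hww
  have hcpr : ∀ u : ∀ j, 𝔛 j, cpr (P fun _ => none) (fun v => v i = x) (agree (pre i) u)
      = cpr (P (setOn A u)) (fun v => v i = x) (agree (pre i) u) := fun u => by
    rw [cpr, cpr, pr_none_and_agree_pre hpa hP hDC hM, pr_none_agree_pre hpa hP hDC hM]
  rw [pr_none_agree_pre hpa hP hDC hM] at hw hw'
  rw [hcpr, hcpr]
  exact hM i w w' w w' x hw hw' (fun j hj => hww j (Finset.mem_inter.1 hj).1)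
    (fun j hj => hww j (Finset.mem_sdiff.1 hj).1)

end CausalPaper
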